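/- Let 𝒜 = {A₁,…,A_n} be a finite set of arguments and let 𝒞 be a satisfiable finite set of linear atomic constraints over 𝒜. Then the optimization problem of maximizing the entropy H(P) over all probability functions P that satisfy 𝒞 has a unique solution P*, the optimization problem of maximizing H(L) over all probability labellings L : 𝒜 → [0,1] that satisfy 𝒞 has a unique solution L*, and these are related by L*(A) = P*(A) for all A ∈ 𝒜. -/

import Mathlib

open Finset

/-- A probability function over a finite set of arguments. -/
def IsProbFun {α : Type*} [Fintype α] [DecidableEq α] (P : Finset α → ℝ) : Prop :=
  (∀ w, 0 ≤ P w ∧ P w ≤ 1) ∧ ∑ w : Finset α, P w = 1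

/-- The probability of an argument under a probability function. -/
def argProb {α : Type*} [Fintype α] [DecidableEq α] (P : Finset α → ℝ) (a : α) : ℝ :=
  ∑ w ∈ univ.filter (fun w : Finset α => a ∈ w), P w

/-- The entropy of a probability function (with `0·log 0 = 0`, as `Real.log 0 = 0`). -/
noncomputable def entP {α : Type*} [Fintype α] [DecidableEq α] (P : Finset α → ℝ) : ℝ :=
  -∑ w : Finset α, P w * Real.log (P w)

open Real in
/-- Gibbs' inequality at a single point. -/
lemma sub_lt_mul_log_sub_mul_log {p q : ℝ} (hp : 0 ≤ p) (hq : 0 ≤ q) (hpq : q = 0 → p = 0)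
    (hne : p ≠ q) : p - q < p * log p - p * log q := by
  rcases hp.eq_or_lt with rfl | hp
  · simpa using lt_of_le_of_ne hq hne
  · have hq : 0 < q := lt_of_le_of_ne hq fun h => hp.ne' (hpq h.symm)
    have h := log_lt_sub_one_of_pos (div_pos hq hp) fun h => hne ((div_eq_one_iff_eq hp.ne').1 h).symm
    rw [log_div hq.ne' hp.ne'] at h
    have h' := mul_lt_mul_of_pos_left h hp
    have : p * (q / p - 1) = q - p := by field_simp
    linarith

open Real in
/-- Strict form of Gibbs' inequality for distinct nonnegative functions with equal sums. -/
lemma sum_mul_log_lt_sum_mul_log {ι : Type*} [Fintype ι] {p q : ι → ℝ} (hp : ∀ i, 0 ≤ p i)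
    (hq : ∀ i, 0 ≤ q i) (hpq : ∀ i, q i = 0 → p i = 0) (hsum : ∑ i, p i = ∑ i, q i)
    (hne : p ≠ q) : ∑ i, p i * log (q i) < ∑ i, p i * log (p i) := by
  obtain ⟨j, hj⟩ := Function.ne_iff.1 hne
  have h : ∑ i, (p i - q i) < ∑ i, (p i * log (p i) - p i * log (q i)) := by
    refine sum_lt_sum (fun i _ => ?_)
      ⟨j, mem_univ j, sub_lt_mul_log_sub_mul_log (hp j) (hq j) (hpq j) hj⟩
    by_cases hi : p i = q i
    · simp [hi]
    · exact (sub_lt_mul_log_sub_mul_log (hp i) (hq i) (hpq i) hi).le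
  simp only [sum_sub_distrib] at h
  linarith

section ProductDistribution

variable {α : Type*} [Fintype α] [DecidableEq α]

/-- The probability function under which the arguments are independent with marginals `L`. -/
def indepProb (L : α → ℝ) (w : Finset α) : ℝ :=
  (∏ a ∈ w, L a) * ∏ a ∈ univ \ w, (1 - L a)

lemma sum_indepProb (L : α → ℝ) : ∑ w, indepProb L w = 1 := by
  have h := prod_add L (fun a => 1 - L a) univ
  simp only [add_sub_cancel, prod_const_one, powerset_univ] at h
  exact h.symm

lemma argProb_indepProb (L : α → ℝ) (a : α) : argProb (indepProb L) a = L a := by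
  have h := prod_add L (Function.update (fun b => 1 - L b) a 0) univ
  rw [powerset_univ, prod_eq_single a (fun b _ hb => by simp [Function.update_of_ne hb])
    (by simp), Function.update_self, add_zero] at h
  rw [h, argProb, sum_filter]
  refine sum_congr rfl fun w _ => ?_
  split_ifs with ha
  · refine congrArg _ (prod_congr rfl fun b hb => ?_)
    rw [Function.update_of_ne]
    rintro rfl
    simp [ha] at hb
  · rw [prod_eq_zero (i := a) (s := univ \ w) (by simpa using ha) (by simp), mul_zero]

lemma indepProb_nonneg {L : α → ℝ} (hL : ∀ a, 0 ≤ L a ∧ L a ≤ 1) (w : Finset α) :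
    0 ≤ indepProb L w :=
  mul_nonneg (prod_nonneg fun a _ => (hL a).1)
    (prod_nonneg fun a _ => sub_nonneg.2 (hL a).2)

lemma isProbFun_of_nonneg {P : Finset α → ℝ} (h0 : ∀ w, 0 ≤ P w) (h1 : ∑ w, P w = 1) :
    IsProbFun P :=
  ⟨fun w => ⟨h0 w, h1 ▸ single_le_sum (fun v _ => h0 v) (mem_univ w)⟩, h1⟩

lemma isProbFun_indepProb {L : α → ℝ} (hL : ∀ a, 0 ≤ L a ∧ L a ≤ 1) :
    IsProbFun (indepProb L) :=
  isProbFun_of_nonneg (indepProb_nonneg hL) (sum_indepProb L)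

lemma one_sub_argProb {P : Finset α → ℝ} (hP : IsProbFun P) (a : α) :
    1 - argProb P a = ∑ w with a ∉ w, P w := by
  rw [← hP.2, argProb, sub_eq_iff_eq_add', sum_filter_add_sum_filter_not]

lemma le_argProb {P : Finset α → ℝ} (hP : IsProbFun P) {a : α} {w : Finset α} (ha : a ∈ w) :
    P w ≤ argProb P a :=
  single_le_sum (f := P) (fun v _ => (hP.1 v).1) (by simpa using ha)

lemma le_one_sub_argProb {P : Finset α → ℝ} (hP : IsProbFun P) {a : α} {w : Finset α}
    (ha : a ∉ w) : P w ≤ 1 - argProb P a := by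
  rw [one_sub_argProb hP]
  exact single_le_sum (f := P) (fun v _ => (hP.1 v).1) (by simpa using ha)

lemma argProb_mem {P : Finset α → ℝ} (hP : IsProbFun P) (a : α) :
    0 ≤ argProb P a ∧ argProb P a ≤ 1 := by
  refine ⟨sum_nonneg fun v _ => (hP.1 v).1, sub_nonneg.1 ?_⟩
  rw [one_sub_argProb hP]
  exact sum_nonneg fun v _ => (hP.1 v).1

lemma eq_zero_of_indepProb_argProb_eq_zero {P : Finset α → ℝ} (hP : IsProbFun P)
    {w : Finset α} (h : indepProb (argProb P) w = 0) : P w = 0 := by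
  refine le_antisymm ?_ (hP.1 w).1
  rcases mul_eq_zero.1 h with h | h <;> obtain ⟨a, ha, h0⟩ := prod_eq_zero_iff.1 h
  · exact h0 ▸ le_argProb hP ha
  · exact h0 ▸ le_one_sub_argProb hP (by simpa using ha)

open Real in
/-- The cross entropy of `P` relative to the product of its marginals. -/
lemma sum_mul_log_indepProb_argProb {P : Finset α → ℝ} (hP : IsProbFun P) :
    ∑ w, P w * log (indepProb (argProb P) w) = -∑ a, binEntropy (argProb P a) := by
  have h (w : Finset α) : P w * log (indepProb (argProb P) w) =
      ∑ a, ((if a ∈ w then P w else 0) * log (argProb P a) +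
        (if a ∉ w then P w else 0) * log (1 - argProb P a)) := by
    by_cases h0 : P w = 0
    · simp [h0]
    have hne := mt (eq_zero_of_indepProb_argProb_eq_zero hP) h0
    rw [indepProb] at hne ⊢
    have hne := mul_ne_zero_iff.1 hne
    rw [log_mul hne.1 hne.2, log_prod (prod_ne_zero_iff.1 hne.1),
      log_prod (prod_ne_zero_iff.1 hne.2), mul_add, mul_sum, mul_sum, sum_add_distrib]
    simp only [ite_mul, zero_mul, ← sum_filter]
    congr 2 <;> ext a <;> simp
  simp_rw [h]
  rw [sum_comm, ← sum_neg_distrib]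
  refine sum_congr rfl fun a _ => ?_
  rw [sum_add_distrib, ← sum_mul, ← sum_mul, ← sum_filter, ← sum_filter,
    ← one_sub_argProb hP, ← argProb, binEntropy, log_inv, log_inv]
  ring

open Real in
lemma entP_indepProb {L : α → ℝ} (hL : ∀ a, 0 ≤ L a ∧ L a ≤ 1) :
    entP (indepProb L) = ∑ a, binEntropy (L a) := by
  have h := sum_mul_log_indepProb_argProb (isProbFun_indepProb hL)
  rw [show argProb (indepProb L) = L from funext (argProb_indepProb L)] at h
  rw [entP, h, neg_neg]

open Real in
/-- Strict subadditivity of entropy away from product distributions. -/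
lemma entP_lt_sum_binEntropy {P : Finset α → ℝ} (hP : IsProbFun P)
    (hne : P ≠ indepProb (argProb P)) : entP P < ∑ a, binEntropy (argProb P a) := by
  have h := sum_mul_log_lt_sum_mul_log (fun w => (hP.1 w).1)
    (indepProb_nonneg (argProb_mem hP)) (fun w => eq_zero_of_indepProb_argProb_eq_zero hP)
    (hP.2.trans (sum_indepProb _).symm) hne
  rw [sum_mul_log_indepProb_argProb hP] at h
  rw [entP]
  linarith

end ProductDistribution

open Real in
lemma strictConcaveOn_sum_binEntropy (α : Type*) [Fintype α] :
    StrictConcaveOn ℝ (Set.Icc (0 : α → ℝ) 1) fun L => ∑ a, binEntropy (L a) := by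
  refine ⟨convex_Icc 0 1, fun x hx y hy hxy s t hs ht hst => ?_⟩
  obtain ⟨b, hb⟩ := Function.ne_iff.1 hxy
  simp only [smul_eq_mul, mul_sum, ← sum_add_distrib]
  exact sum_lt_sum
    (fun a _ => strictConcave_binEntropy.concaveOn.2 ⟨hx.1 a, hx.2 a⟩ ⟨hy.1 a, hy.2 a⟩
      hs.le ht.le hst)
    ⟨b, mem_univ b, strictConcave_binEntropy.2 ⟨hx.1 b, hx.2 b⟩ ⟨hy.1 b, hy.2 b⟩ hb hs ht hst⟩

/-- A continuous strictly concave function on a nonempty compact convex set has a strict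
global maximizer. -/
lemma StrictConcaveOn.exists_forall_ne_lt {E : Type*} [AddCommGroup E] [Module ℝ E]
    [TopologicalSpace E] {K : Set E} {f : E → ℝ} (hf : StrictConcaveOn ℝ K f)
    (hK : IsCompact K) (hne : K.Nonempty) (hc : ContinuousOn f K) :
    ∃ x ∈ K, ∀ y ∈ K, y ≠ x → f y < f x := by
  obtain ⟨x, hx, hmax⟩ := hK.exists_isMaxOn hne hc
  refine ⟨x, hx, fun y hy hyx => lt_of_not_ge fun hxy => hyx ?_⟩
  exact hf.eq_of_isMaxOn (fun z hz => (hmax hz).trans hxy) hmax hy hx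

/-- Let `𝒜 = {A₁,…,Aₙ}` and let `𝒞` be a satisfiable finite set of linear atomic
constraints.  Maximizing entropy over all probability functions satisfying `𝒞` has a unique
solution `P*`, maximizing entropy over all probability labellings satisfying `𝒞` has a
unique solution `L*`, and `L*(A) = P*(A)` for all arguments `A`.  Uniqueness of the
maximizers is expressed by strict inequality for every other feasible point. -/
theorem stmt9 {α : Type*} [Fintype α] [DecidableEq α] (n m : ℕ)
    (A : Fin n → α) (hA : Function.Bijective A)
    (c : Fin m → Fin n → ℝ) (c₀ : Fin m → ℝ)
    (hsat : ∃ P : Finset α → ℝ, IsProbFun P ∧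
      ∀ j : Fin m, ∑ i, c j i * argProb P (A i) ≤ c₀ j) :
    ∃ (Pstar : Finset α → ℝ) (Lstar : α → ℝ),
      (IsProbFun Pstar ∧ (∀ j : Fin m, ∑ i, c j i * argProb Pstar (A i) ≤ c₀ j) ∧
        ∀ P : Finset α → ℝ, IsProbFun P →
          (∀ j : Fin m, ∑ i, c j i * argProb P (A i) ≤ c₀ j) →
          P ≠ Pstar → entP P < entP Pstar) ∧
      ((∀ a, 0 ≤ Lstar a ∧ Lstar a ≤ 1) ∧
        (∀ j : Fin m, ∑ i, c j i * Lstar (A i) ≤ c₀ j) ∧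
        ∀ L : α → ℝ, (∀ a, 0 ≤ L a ∧ L a ≤ 1) →
          (∀ j : Fin m, ∑ i, c j i * L (A i) ≤ c₀ j) → L ≠ Lstar →
          (∑ i : Fin n, (-(L (A i) * Real.log (L (A i))) -
              (1 - L (A i)) * Real.log (1 - L (A i)))) <
          (∑ i : Fin n, (-(Lstar (A i) * Real.log (Lstar (A i))) -
              (1 - Lstar (A i)) * Real.log (1 - Lstar (A i))))) ∧
      (∀ a : α, Lstar a = argProb Pstar a) := by
  have hent (L : α → ℝ) : (∑ i : Fin n, (-(L (A i) * Real.log (L (A i))) -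
      (1 - L (A i)) * Real.log (1 - L (A i)))) = ∑ a, Real.binEntropy (L a) := by
    rw [← hA.sum_comp fun a => Real.binEntropy (L a)]
    refine sum_congr rfl fun i _ => ?_
    rw [Real.binEntropy, Real.log_inv, Real.log_inv]
    ring
  let C : Set (α → ℝ) := {L | ∀ j : Fin m, ∑ i, c j i * L (A i) ≤ c₀ j}
  have hC_closed : IsClosed C := by
    simp only [C, Set.ofPred_forall]
    exact isClosed_iInter fun j => isClosed_le (by fun_prop) continuous_const
  have hC_convex : Convex ℝ C := by
    intro x hx y hy s t hs ht hst j
    calc ∑ i, c j i * (s • x + t • y) (A i)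
        = s * ∑ i, c j i * x (A i) + t * ∑ i, c j i * y (A i) := by
          simp only [mul_sum, ← sum_add_distrib, Pi.add_apply, Pi.smul_apply, smul_eq_mul]
          exact sum_congr rfl fun i _ => by ring
      _ ≤ s * c₀ j + t * c₀ j := by gcongr <;> [exact hx j; exact hy j]
      _ = c₀ j := by rw [← add_mul, hst, one_mul]
  obtain ⟨P₀, hP₀, hcP₀⟩ := hsat
  obtain ⟨L, ⟨hL, hcL⟩, hmax⟩ :=
    ((strictConcaveOn_sum_binEntropy α).subset Set.inter_subset_left
      ((convex_Icc 0 1).inter hC_convex)).exists_forall_ne_lt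
      (isCompact_Icc.inter_right hC_closed)
      ⟨argProb P₀, ⟨fun a => (argProb_mem hP₀ a).1, fun a => (argProb_mem hP₀ a).2⟩, hcP₀⟩
      (by fun_prop)
  have hL' : ∀ a, 0 ≤ L a ∧ L a ≤ 1 := fun a => ⟨hL.1 a, hL.2 a⟩
  refine ⟨indepProb L, L, ⟨isProbFun_indepProb hL', fun j => by
      simpa only [argProb_indepProb] using hcL j,
    fun P hP hcP hne => ?_⟩, ⟨hL', hcL, fun L' hL₁ hcL₁ hne => ?_⟩,
    fun a => (argProb_indepProb L a).symm⟩
  · rw [entP_indepProb hL']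
    by_cases h : argProb P = L
    · subst h
      exact entP_lt_sum_binEntropy hP hne
    · have hlt := hmax (argProb P)
        ⟨⟨fun a => (argProb_mem hP a).1, fun a => (argProb_mem hP a).2⟩, hcP⟩ h
      refine lt_of_le_of_lt ?_ hlt
      by_cases hind : P = indepProb (argProb P)
      · conv_lhs => rw [hind]
        exact (entP_indepProb (argProb_mem hP)).le
      · exact (entP_lt_sum_binEntropy hP hind).le
  · rw [hent, hent]
    exact hmax L' ⟨⟨fun a => (hL₁ a).1, fun a => (hL₁ a).2⟩, hcL₁⟩ hne
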